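/- arXiv:2508.21502 — 3 statements merged into one kernel-verified Lean document; each statement's English description precedes it below -/
import Mathlib

section
/- Let t > 0 and m > 0, let E(t,m,k) := √(m² + 4t² + 2t²·cos(2k₁) + 2t²·cos(2k₂)), and for an even integer L ≥ 2 and θ, φ ∈ ℝ define the ground-state energy of the π-flux Hamiltonian with holonomies (e^{iθ}, e^{iφ}) by E₀(L,θ,φ) := −2 · Σ_{n₁=0}^{L/2−1} Σ_{n₂=0}^{L/2−1} E(t, m, ((2πn₁+θ)/L, (2πn₂+φ)/L)). Then there exist constants C > 0 and c > 0 depending only on t and m such that for every even L ≥ 2 and all θ, φ, θ', φ' ∈ ℝ, |E₀(L,θ,φ) − E₀(L,θ',φ')| ≤ C·L²·e^{−cL}. -/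
/-- The positive-energy band of the π-flux Bloch Hamiltonian. -/
noncomputable def bandE (t m k₁ k₂ : ℝ) : ℝ :=
  Real.sqrt (m ^ 2 + 4 * t ^ 2 + 2 * t ^ 2 * Real.cos (2 * k₁)
    + 2 * t ^ 2 * Real.cos (2 * k₂))

/-- The (spinful, non-interacting) ground-state energy of the π-flux Hamiltonian on the
`L × L` torus with `U(1)` holonomies `(e^{iθ}, e^{iφ})`:
`E₀ = −2 Σ_{k ∈ B_L(θ,φ)} E(t,m,k)` over the twisted Brillouin zone. -/
noncomputable def gsEnergy (t m : ℝ) (L : ℕ) (θ φ : ℝ) : ℝ :=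
  -2 * ∑ n₁ ∈ Finset.range (L / 2), ∑ n₂ ∈ Finset.range (L / 2),
    bandE t m ((2 * Real.pi * n₁ + θ) / L) ((2 * Real.pi * n₂ + φ) / L)

open Finset in
lemma aux_sqrt_approx (q : ℝ) (hq0 : 0 ≤ q) (hq : q < 1) :
    ∃ a ∈ Set.Ioo (0 : ℝ) 1, ∃ C > 0, ∃ b : ℕ → ℝ, ∀ u : ℝ, |u| ≤ q → ∀ n : ℕ,
      |Real.sqrt (1 + u) - ∑ k ∈ range n, b k * u ^ k| ≤ C * a ^ n := by
  have h := Real.one_add_rpow_hasFPowerSeriesOnBall_zero (a := 1 / 2)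
  obtain ⟨r, hr⟩ : ∃ r : NNReal, (r : ℝ) = (1 + q) / 2 := ⟨⟨(1 + q) / 2, by linarith⟩, rfl⟩
  have hr1 : (r : ENNReal) < 1 := by
    rw [ENNReal.coe_lt_one_iff, ← NNReal.coe_lt_coe, hr, NNReal.coe_one]; linarith
  obtain ⟨a, ha, C, hC, H⟩ := h.uniform_geometric_approx hr1
  refine ⟨a, ha, C, hC, fun k => (binomialSeries ℝ (1 / 2 : ℝ)).coeff k, fun u hu n => ?_⟩
  have := H u (by rw [mem_ball_zero_iff, hr, Real.norm_eq_abs]; linarith) n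
  simpa [FormalMultilinearSeries.partialSum, Real.sqrt_eq_rpow, Real.norm_eq_abs, mul_comm] using this

/-- Shift independence of the base exponential sums. -/
lemma aux_exp_sum (N : ℕ) (hN : 0 < N) (p : ℤ) (hp : |p| < N) (α β : ℝ) :
    ∑ n ∈ Finset.range N, Complex.exp (Complex.I * p * ((2 * Real.pi * n / N + α : ℝ) : ℂ)) =
    ∑ n ∈ Finset.range N, Complex.exp (Complex.I * p * ((2 * Real.pi * n / N + β : ℝ) : ℂ)) := by
  by_cases h0 : p = 0
  · simp [h0]
  have hN' : (N : ℂ) ≠ 0 := by exact_mod_cast hN.ne'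
  have hprim := Complex.isPrimitiveRoot_exp N hN.ne'
  set ζ := Complex.exp (2 * Real.pi * Complex.I / N) with hζ
  have hne : ζ ^ p ≠ 1 := by
    rw [Ne, hprim.zpow_eq_one_iff_dvd]
    intro hd
    exact h0 (Int.eq_zero_of_abs_lt_dvd hd hp)
  have key : ∀ γ : ℝ, ∑ n ∈ Finset.range N,
      Complex.exp (Complex.I * p * ((2 * Real.pi * n / N + γ : ℝ) : ℂ)) = 0 := by
    intro γ
    have : ∀ n ∈ Finset.range N,
        Complex.exp (Complex.I * p * ((2 * Real.pi * n / N + γ : ℝ) : ℂ)) =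
        Complex.exp (Complex.I * p * γ) * (ζ ^ p) ^ n := by
      intro n _
      rw [hζ, ← Complex.exp_int_mul, ← Complex.exp_nat_mul, ← Complex.exp_add]
      congr 1
      push_cast
      ring
    rw [Finset.sum_congr rfl this, ← Finset.mul_sum, geom_sum_eq hne]
    have : (ζ ^ p) ^ N = 1 := by
      rw [← zpow_natCast, ← zpow_mul, mul_comm, zpow_mul, zpow_natCast, hprim.pow_eq_one, one_zpow]
    rw [this]; simp
  rw [key, key]

lemma aux_cos_exp_sum (N : ℕ) (hN : 0 < N) (α β : ℝ) (j : ℕ) : ∀ (p : ℤ), |p| + j < N →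
    ∑ n ∈ Finset.range N, (Complex.cos ((2 * Real.pi * n / N + α : ℝ) : ℂ)) ^ j *
      Complex.exp (Complex.I * p * ((2 * Real.pi * n / N + α : ℝ) : ℂ)) =
    ∑ n ∈ Finset.range N, (Complex.cos ((2 * Real.pi * n / N + β : ℝ) : ℂ)) ^ j *
      Complex.exp (Complex.I * p * ((2 * Real.pi * n / N + β : ℝ) : ℂ)) := by
  induction j with
  | zero =>
    intro p hp
    simpa using aux_exp_sum N hN p (by simpa using hp) α β
  | succ j ih =>
    intro p hp
    push_cast at hp
    have h1 := ih (p + 1) (by have := abs_add_le p 1; simp at this; omega)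
    have h2 := ih (p - 1) (by have := abs_sub p 1; simp at this; omega)
    have key : ∀ x : ℂ, Complex.cos x ^ (j + 1) * Complex.exp (Complex.I * p * x) =
        (Complex.cos x ^ j * Complex.exp (Complex.I * ((p + 1 : ℤ) : ℂ) * x) +
        Complex.cos x ^ j * Complex.exp (Complex.I * ((p - 1 : ℤ) : ℂ) * x)) / 2 := by
      intro x
      have e1 : Complex.exp (Complex.I * ((p + 1 : ℤ) : ℂ) * x) =
          Complex.exp (Complex.I * p * x) * Complex.exp (x * Complex.I) := by
        rw [← Complex.exp_add]; congr 1; push_cast; ring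
      have e2 : Complex.exp (Complex.I * ((p - 1 : ℤ) : ℂ) * x) =
          Complex.exp (Complex.I * p * x) * Complex.exp (-x * Complex.I) := by
        rw [← Complex.exp_add]; congr 1; push_cast; ring
      rw [e1, e2, pow_succ]
      nth_rewrite 2 [Complex.cos]
      ring
    simp only [key, ← Finset.sum_div, Finset.sum_add_distrib, h1, h2]

lemma aux_cos_sum (N : ℕ) (α β : ℝ) (j : ℕ) (hj : j < N) :
    ∑ n ∈ Finset.range N, (Real.cos (2 * Real.pi * n / N + α)) ^ j =
    ∑ n ∈ Finset.range N, (Real.cos (2 * Real.pi * n / N + β)) ^ j := by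
  have h := aux_cos_exp_sum N (by omega) α β j 0 (by simpa using hj)
  simp only [Int.cast_zero, mul_zero, zero_mul, Complex.exp_zero, mul_one] at h
  exact_mod_cast h

lemma aux_double_sum (N : ℕ) (α β α' β' : ℝ) (k : ℕ) (hk : k < N) :
    ∑ n₁ ∈ Finset.range N, ∑ n₂ ∈ Finset.range N,
      (Real.cos (2 * Real.pi * n₁ / N + α) + Real.cos (2 * Real.pi * n₂ / N + β)) ^ k =
    ∑ n₁ ∈ Finset.range N, ∑ n₂ ∈ Finset.range N,
      (Real.cos (2 * Real.pi * n₁ / N + α') + Real.cos (2 * Real.pi * n₂ / N + β')) ^ k := by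
  have key : ∀ a b : ℝ, ∑ n₁ ∈ Finset.range N, ∑ n₂ ∈ Finset.range N,
      (Real.cos (2 * Real.pi * n₁ / N + a) + Real.cos (2 * Real.pi * n₂ / N + b)) ^ k =
      ∑ j ∈ Finset.range (k + 1), (∑ n ∈ Finset.range N, Real.cos (2 * Real.pi * n / N + a) ^ j) *
        (∑ n ∈ Finset.range N, Real.cos (2 * Real.pi * n / N + b) ^ (k - j)) * (k.choose j) := by
    intro a b
    simp only [add_pow]
    rw [Finset.sum_congr rfl (fun n _ => Finset.sum_comm), Finset.sum_comm]
    refine Finset.sum_congr rfl fun j _ => ?_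
    rw [Finset.sum_mul_sum, Finset.sum_mul]
    refine Finset.sum_congr rfl fun n _ => ?_
    rw [Finset.sum_mul]
  rw [key, key]
  refine Finset.sum_congr rfl fun j hj => ?_
  rw [Finset.mem_range] at hj
  rw [aux_cos_sum N α α' j (by omega), aux_cos_sum N β β' (k - j) (by omega)]

/-- Exponential closeness of the ground-state energies for different holonomies: for
`t, m > 0` there are constants `C, c > 0` depending only on `t, m` such that for all even
`L ≥ 2` and all twists `θ, φ, θ', φ'`,
`|E₀(L,θ,φ) − E₀(L,θ',φ')| ≤ C L² e^{−cL}`. -/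
theorem gsEnergy_holonomy_closeness (t m : ℝ) (ht : 0 < t) (hm : 0 < m) :
    ∃ C > 0, ∃ c > 0, ∀ L : ℕ, Even L → 2 ≤ L → ∀ θ φ θ' φ' : ℝ,
      |gsEnergy t m L θ φ - gsEnergy t m L θ' φ'| ≤
        C * (L : ℝ) ^ 2 * Real.exp (-c * L) := by
  set M : ℝ := m ^ 2 + 4 * t ^ 2 with hM
  have hMpos : 0 < M := by positivity
  obtain ⟨a, ⟨ha0, ha1⟩, C, hC, b, hb⟩ := aux_sqrt_approx (4 * t ^ 2 / M) (by positivity)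
    (by rw [div_lt_one hMpos]; have := pow_pos hm 2; linarith)
  have hsM : 0 < Real.sqrt M := Real.sqrt_pos.2 hMpos
  refine ⟨Real.sqrt M * C, by positivity, -Real.log a / 2,
    by have := Real.log_neg ha0 ha1; linarith, ?_⟩
  intro L hL hL2 θ φ θ' φ'
  obtain ⟨N, rfl⟩ := hL
  have hN : 0 < N := by omega
  have hNR : (0 : ℝ) < N := by exact_mod_cast hN
  have hdiv : (N + N) / 2 = N := by omega
  set g : ℝ → ℝ → ℝ := fun x y => 2 * t ^ 2 / M * (Real.cos x + Real.cos y) with hg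
  -- the polynomial approximant
  set P : ℝ → ℝ → ℝ := fun x y => ∑ k ∈ Finset.range N, b k * g x y ^ k with hP
  have hband : ∀ k₁ k₂ : ℝ, bandE t m k₁ k₂ = Real.sqrt M * Real.sqrt (1 + g (2 * k₁) (2 * k₂)) := by
    intro k₁ k₂
    rw [← Real.sqrt_mul hMpos.le, bandE]
    congr 1
    simp only [hg]
    field_simp
    rw [hM]; ring
  have hgb : ∀ x y, |g x y| ≤ 4 * t ^ 2 / M := by
    intro x y
    have h1 := abs_add_le (Real.cos x) (Real.cos y)
    have h2 := Real.abs_cos_le_one x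
    have h3 := Real.abs_cos_le_one y
    have h4 : 0 < 2 * t ^ 2 / M := by positivity
    simp only [hg]
    rw [abs_mul, abs_of_pos h4]
    calc 2 * t ^ 2 / M * |Real.cos x + Real.cos y| ≤ 2 * t ^ 2 / M * 2 := by gcongr; linarith
      _ = _ := by ring
  have hclose : ∀ x y, |Real.sqrt (1 + g x y) - P x y| ≤ C * a ^ N := fun x y => hb _ (hgb x y) N
  set S : ℝ → ℝ → ℝ := fun α β => ∑ n₁ ∈ Finset.range N, ∑ n₂ ∈ Finset.range N,
    P (2 * Real.pi * n₁ / N + α) (2 * Real.pi * n₂ / N + β) with hS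
  have hSconst : ∀ α β α' β', S α β = S α' β' := by
    intro α β α' β'
    have key : ∀ α β, S α β = ∑ k ∈ Finset.range N, b k * (2 * t ^ 2 / M) ^ k *
        ∑ n₁ ∈ Finset.range N, ∑ n₂ ∈ Finset.range N,
      (Real.cos (2 * Real.pi * n₁ / N + α) + Real.cos (2 * Real.pi * n₂ / N + β)) ^ k := by
      intro α β
      simp only [hS, hP, hg, Finset.mul_sum, mul_pow]
      rw [Finset.sum_comm' (t' := Finset.range N) (s' := fun _ => Finset.range N)
        (s := Finset.range N) (t := fun _ => Finset.range N) (by simp)]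
      rw [Finset.sum_comm]
      conv_rhs => rw [Finset.sum_comm]
      refine Finset.sum_congr rfl fun n _ => ?_
      rw [Finset.sum_comm]
      simp only [mul_assoc]
    rw [key, key]
    refine Finset.sum_congr rfl fun k hk => ?_
    rw [aux_double_sum N α β α' β' k (Finset.mem_range.1 hk)]
  have hE : ∀ θ φ : ℝ, |gsEnergy t m (N + N) θ φ - (-2 * Real.sqrt M * S (θ / N) (φ / N))| ≤
      2 * Real.sqrt M * (N ^ 2 * (C * a ^ N)) := by
    intro θ φ
    have e : gsEnergy t m (N + N) θ φ - (-2 * Real.sqrt M * S (θ / N) (φ / N)) =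
        -(2 * Real.sqrt M * ∑ n₁ ∈ Finset.range N, ∑ n₂ ∈ Finset.range N,
          (Real.sqrt (1 + g (2 * Real.pi * n₁ / N + θ / N) (2 * Real.pi * n₂ / N + φ / N)) -
            P (2 * Real.pi * n₁ / N + θ / N) (2 * Real.pi * n₂ / N + φ / N))) := by
      have hx : ∀ (n : ℕ) (γ : ℝ), 2 * ((2 * Real.pi * n + γ) / ((N + N : ℕ) : ℝ)) =
          2 * Real.pi * n / N + γ / N := by
        intro n γ; push_cast; field_simp; ring
      simp only [gsEnergy, hdiv, hband, hx, ← Finset.mul_sum, Finset.sum_sub_distrib, hS]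
      ring
    rw [e, abs_neg, abs_mul, abs_of_pos (by positivity : 0 < 2 * Real.sqrt M)]
    gcongr
    refine (Finset.abs_sum_le_sum_abs _ _).trans ?_
    calc _ ≤ ∑ n₁ ∈ Finset.range N, (N : ℝ) * (C * a ^ N) := by
          refine Finset.sum_le_sum fun n₁ _ => ?_
          refine (Finset.abs_sum_le_sum_abs _ _).trans ?_
          refine (Finset.sum_le_sum fun n₂ _ => hclose _ _).trans ?_
          simp
      _ = _ := by simp; ring
  have h1 := hE θ φ
  have h2 := hE θ' φ'
  rw [hSconst (θ' / N) (φ' / N) (θ / N) (φ / N), abs_sub_comm] at h2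
  have hexp : Real.exp (-(-Real.log a / 2) * ((N + N : ℕ) : ℝ)) = a ^ N := by
    rw [← Real.exp_log (pow_pos ha0 N), Real.log_pow]
    congr 1; push_cast; ring
  rw [hexp]
  refine (abs_sub_le _ _ _).trans ((add_le_add h1 h2).trans (le_of_eq ?_))
  push_cast; ring
end

section
/- For all m ∈ ℝ and k = (k₁,k₂) ∈ ℝ², the characteristic polynomial of the 8×8 chessboard Bloch Hamiltonian H₈(m,k) equals ((X² − λ₊(k))·(X² − λ₋(k)))² in ℂ[X], where λ_±(k) = m² + 4 ± 2·√(1 + cos²(2k₁) + cos²(2k₂)); in particular its eigenvalues are ±√(λ₊(k)) and ±√(λ₋(k)), each with multiplicity two. -/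
open Complex Polynomial

/-- The 8×8 chessboard Bloch Hamiltonian (hopping `t = 1`, staggered mass `m`) arising from
the chessboard monopole configuration carved on the uniform π-flux background. -/
noncomputable def chessH (m k₁ k₂ : ℝ) : Matrix (Fin 8) (Fin 8) ℂ :=
  !![-(m : ℂ), 1, 0, exp (-4 * I * k₁), 1 + exp (-2 * I * k₂), 0, 0, 0;
     1, m, 1, 0, 0, -1 + exp (-2 * I * k₂), 0, 0;
     0, 1, -m, 1, 0, 0, -1 + exp (-2 * I * k₂), 0;
     exp (4 * I * k₁), 0, 1, m, 0, 0, 0, 1 + exp (-2 * I * k₂);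
     1 + exp (2 * I * k₂), 0, 0, 0, m, -1, 0, -exp (-4 * I * k₁);
     0, -1 + exp (2 * I * k₂), 0, 0, -1, -m, -1, 0;
     0, 0, -1 + exp (2 * I * k₂), 0, 0, -1, m, -1;
     0, 0, 0, 1 + exp (2 * I * k₂), -exp (4 * I * k₁), 0, -1, -m]

/-- Block determinant with scalar diagonal blocks. -/
lemma chess_det_block (a b : ℂ) (hb : b ≠ 0) (D E : Matrix (Fin 4) (Fin 4) ℂ) :
    (Matrix.fromBlocks (a • (1 : Matrix (Fin 4) (Fin 4) ℂ)) (-D) (-E) (b • 1)).det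
      = ((a * b) • (1 : Matrix (Fin 4) (Fin 4) ℂ) - D * E).det := by
  have h : Matrix.fromBlocks (a • (1 : Matrix (Fin 4) (Fin 4) ℂ)) (-D) (-E) (b • 1)
      * Matrix.fromBlocks (b • 1) 0 E 1
      = Matrix.fromBlocks ((a * b) • (1 : Matrix (Fin 4) (Fin 4) ℂ) - D * E) (-D) 0 (b • 1) := by
    rw [Matrix.fromBlocks_multiply]
    congr 1 <;> simp [smul_smul, sub_eq_add_neg]
    rw [mul_comm]
  have h2 := congrArg Matrix.det h
  rw [Matrix.det_mul, Matrix.det_fromBlocks_zero₁₂, Matrix.det_fromBlocks_zero₂₁] at h2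
  have h3 : (b • (1 : Matrix (Fin 4) (Fin 4) ℂ)).det ≠ 0 := by
    simp [Matrix.det_smul, hb]
  rw [Matrix.det_one, mul_one] at h2
  exact mul_right_cancel₀ h3 h2

/-- The two sublattices of the chessboard. -/
def chessEquiv : Fin 4 ⊕ Fin 4 ≃ Fin 8 where
  toFun := Sum.elim ![0, 2, 5, 7] ![1, 3, 4, 6]
  invFun := ![.inl 0, .inr 0, .inl 1, .inr 1, .inr 2, .inl 2, .inr 3, .inl 3]
  left_inv := by decide
  right_inv := by decide

/-- The `4 × 4` determinant left after eliminating one sublattice. -/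
lemma chess_det4 (w z y : ℂ) (hw : w ≠ 0) (hz : z ≠ 0) :
    (y • (1 : Matrix (Fin 4) (Fin 4) ℂ) -
      !![1, w, 1 + z, 0; 1, 1, 0, -1 + z; -1 + z⁻¹, 0, -1, -1; 0, 1 + z⁻¹, -w⁻¹, -1] *
      !![1, 1, -1 + z, 0; w⁻¹, 1, 0, 1 + z; 1 + z⁻¹, 0, -1, -w; 0, -1 + z⁻¹, -1, -1]).det
      = ((y - 4) ^ 2 - (4 + (w + 2 + w⁻¹) + (z ^ 2 + 2 + z⁻¹ ^ 2))) ^ 2 := by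
  have e : (y • (1 : Matrix (Fin 4) (Fin 4) ℂ) -
      !![1, w, 1 + z, 0; 1, 1, 0, -1 + z; -1 + z⁻¹, 0, -1, -1; 0, 1 + z⁻¹, -w⁻¹, -1] *
      !![1, 1, -1 + z, 0; w⁻¹, 1, 0, 1 + z; 1 + z⁻¹, 0, -1, -w; 0, -1 + z⁻¹, -1, -1])
      = !![y - 4 - (z + z⁻¹), -(1 + w), 2, 0;
           -(1 + w⁻¹), y - 4 + (z + z⁻¹), 0, -2;
           2, 0, y - 4 + (z + z⁻¹), -(1 + w);
           0, -2, -(1 + w⁻¹), y - 4 - (z + z⁻¹)] := by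
    ext i j
    fin_cases i <;> fin_cases j <;>
      simp [Matrix.mul_apply, Fin.sum_univ_four, Matrix.one_apply] <;> field_simp <;> ring
  rw [e]
  simp [Matrix.det_succ_row_zero, Fin.sum_univ_succ, Fin.succAbove]
  field_simp
  ring

/-- The characteristic polynomial of the chessboard Bloch Hamiltonian is
`((X² − λ₊(k))(X² − λ₋(k)))²` with `λ_± = m² + 4 ± 2√(1 + cos²(2k₁) + cos²(2k₂))`;
in particular its eigenvalues are `±√λ₊(k)`, `±√λ₋(k)`, each with multiplicity two. -/
theorem chessH_charpoly (m k₁ k₂ : ℝ) :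
    (chessH m k₁ k₂).charpoly =
      ((X ^ 2 - C ((m ^ 2 + 4
          + 2 * Real.sqrt (1 + Real.cos (2 * k₁) ^ 2 + Real.cos (2 * k₂) ^ 2) : ℝ) : ℂ)) *
       (X ^ 2 - C ((m ^ 2 + 4
          - 2 * Real.sqrt (1 + Real.cos (2 * k₁) ^ 2 + Real.cos (2 * k₂) ^ 2) : ℝ) : ℂ))) ^ 2 := by
  apply Polynomial.eq_of_infinite_eval_eq
  refine Set.Infinite.mono (s := {(m : ℂ)}ᶜ) ?_ (Set.finite_singleton _).infinite_compl
  intro t ht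
  have ht' : t - m ≠ 0 := sub_ne_zero.mpr ht
  have hw : exp (4 * I * k₁) = (exp (-4 * I * k₁))⁻¹ := by
    rw [← Complex.exp_neg]; congr 1; ring
  have hz : exp (2 * I * k₂) = (exp (-2 * I * k₂))⁻¹ := by
    rw [← Complex.exp_neg]; congr 1; ring
  have hc1 : 4 * Complex.cos (2 * k₁) ^ 2 = exp (-4 * I * k₁) + 2 + (exp (-4 * I * k₁))⁻¹ := by
    have h1 : exp (-4 * I * k₁) = exp (-(2 * k₁) * I) ^ 2 := by
      rw [← Complex.exp_nat_mul]; congr 1; push_cast; ring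
    have h2 : exp (2 * k₁ * I) = (exp (-(2 * k₁) * I))⁻¹ := by
      rw [← Complex.exp_neg]; congr 1; ring
    rw [Complex.cos, h1, h2]
    have := Complex.exp_ne_zero (-(2 * k₁) * I)
    field_simp
    ring
  have hc2 : 4 * Complex.cos (2 * k₂) ^ 2
      = exp (-2 * I * k₂) ^ 2 + 2 + (exp (-2 * I * k₂))⁻¹ ^ 2 := by
    have h1 : exp (-2 * I * k₂) = exp (-(2 * k₂) * I) := by
      congr 1; ring
    have h2 : exp (2 * k₂ * I) = (exp (-(2 * k₂) * I))⁻¹ := by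
      rw [← Complex.exp_neg]; congr 1; ring
    rw [Complex.cos, h1, h2]
    have := Complex.exp_ne_zero (-(2 * k₂) * I)
    field_simp
    ring
  have hs : ((Real.sqrt (1 + Real.cos (2 * k₁) ^ 2 + Real.cos (2 * k₂) ^ 2) : ℝ) : ℂ) ^ 2
      = 1 + Complex.cos (2 * k₁) ^ 2 + Complex.cos (2 * k₂) ^ 2 := by
    rw [← Complex.ofReal_pow, Real.sq_sqrt (by positivity)]
    push_cast; rfl
  have hw0 := Complex.exp_ne_zero (-4 * I * k₁)
  have hz0 := Complex.exp_ne_zero (-2 * I * k₂)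
  have key : (Matrix.scalar (Fin 8) t - chessH m k₁ k₂).det
      = (((t - m) * (t + m) - 4) ^ 2 - (4 + 4 * Complex.cos (2 * k₁) ^ 2
        + 4 * Complex.cos (2 * k₂) ^ 2)) ^ 2 := by
    rw [hc1, hc2, ← chess_det4 _ _ _ hw0 hz0, mul_comm (t - m), ← chess_det_block _ _ ht',
      ← Matrix.det_submatrix_equiv_self chessEquiv]
    congr 1
    unfold chessH
    rw [hw, hz]
    generalize exp (-4 * I * k₁) = w
    generalize exp (-2 * I * k₂) = z
    ext i j
    rcases i with i | i <;> rcases j with j | j <;> fin_cases i <;> fin_cases j <;>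
      simp [chessEquiv, Matrix.one_apply, Matrix.scalar_apply, Matrix.diagonal_apply] <;> ring
  simp only [Set.mem_ofPred_eq, Matrix.eval_charpoly, key, eval_pow, eval_mul, eval_sub, eval_X,
    eval_C]
  push_cast at hs ⊢
  congr 1
  linear_combination (4 : ℂ) * hs
end

section
/- Let L be a positive multiple of 4 and t, m ∈ ℝ, and let M be the one-body π-flux Hamiltonian on the torus (ZMod L)². Then the characteristic polynomial of M equals Π_{n₁=0}^{L/2−1} Π_{n₂=0}^{L/2−1} (X² − (m² + 4t² + 2t²·cos(4πn₁/L) + 2t²·cos(4πn₂/L)))²; in particular the eigenvalues of M are ±√(m² + 4t² + 2t²·cos(2k₁) + 2t²·cos(2k₂)) for k in the Brillouin zone B_L(1,1) = {(2πn₁/L, 2πn₂/L) : 0 ≤ n₁,n₂ ≤ L/2−1}, each appearing twice. -/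
open Polynomial

/-- The one-body π-flux Hamiltonian on the torus `(ZMod L)²`: staggered mass
`m(−1)^{i₁+i₂}` on the diagonal, horizontal hopping `−t(−1)^{i₂}` (the gauge with
ℤ₂-field `(−1)^{i₂}` on horizontal edges, carrying a π-flux through every plaquette and
trivial holonomies), and vertical hopping `−t`. -/
noncomputable def piFluxM (L : ℕ) (t m : ℝ) :
    Matrix (ZMod L × ZMod L) (ZMod L × ZMod L) ℝ := fun i j =>
  if j = i then m * (-1 : ℝ) ^ (i.1.val + i.2.val)
  else if j = (i.1 + 1, i.2) ∨ j = (i.1 - 1, i.2) then -t * (-1 : ℝ) ^ i.2.val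
  else if j = (i.1, i.2 + 1) ∨ j = (i.1, i.2 - 1) then -t
  else 0

namespace PiFlux

/-- The staggered sign on `ZMod L`. -/
noncomputable def sg {L : ℕ} (n : ZMod L) : ℂ := (-1 : ℂ) ^ n.val

lemma sg_add_one {L : ℕ} [NeZero L] (hL : 4 ∣ L) (n : ZMod L) : sg (n + 1) = - sg n := by
  have h2 : 2 ∣ L := dvd_trans (by norm_num) hL
  have h1 : 1 < L := by
    have := Nat.le_of_dvd (Nat.pos_of_ne_zero (NeZero.ne L)) hL
    omega
  have : Fact (1 < L) := ⟨h1⟩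
  unfold sg
  rw [ZMod.val_add, ZMod.val_one, neg_one_pow_eq_pow_mod_two, Nat.mod_mod_of_dvd _ h2,
    ← neg_one_pow_eq_pow_mod_two, pow_succ]
  ring

lemma sg_sub_one {L : ℕ} [NeZero L] (hL : 4 ∣ L) (n : ZMod L) : sg (n - 1) = - sg n := by
  have := sg_add_one hL (n - 1)
  rw [sub_add_cancel] at this
  rw [this, neg_neg]

lemma sg_sq {L : ℕ} (n : ZMod L) : sg n * sg n = 1 := by
  unfold sg
  rw [← mul_pow]; simp

/-- Complexified Hamiltonian. -/
noncomputable def Mc (L : ℕ) (t m : ℝ) : Matrix (ZMod L × ZMod L) (ZMod L × ZMod L) ℂ :=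
  (piFluxM L t m).map (algebraMap ℝ ℂ)

lemma one_ne {L : ℕ} [NeZero L] (hL : 4 ∣ L) : (1 : ZMod L) ≠ 0 := by
  have h := Nat.le_of_dvd (Nat.pos_of_ne_zero (NeZero.ne L)) hL
  intro h0
  have h1 : ((1 : ℕ) : ZMod L) = 0 := by simpa using h0
  rw [ZMod.natCast_eq_zero_iff] at h1
  have := Nat.le_of_dvd (by norm_num) h1
  omega

lemma add_ne_sub {L : ℕ} [NeZero L] (hL : 4 ∣ L) (a : ZMod L) : a + 1 ≠ a - 1 := by
  have h := Nat.le_of_dvd (Nat.pos_of_ne_zero (NeZero.ne L)) hL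
  intro h0
  have h1 : ((2 : ℕ) : ZMod L) = 0 := by
    push_cast
    linear_combination h0
  rw [ZMod.natCast_eq_zero_iff] at h1
  have := Nat.le_of_dvd (by norm_num) h1
  omega

lemma Mc_apply {L : ℕ} [NeZero L] (hL : 4 ∣ L) (t m : ℝ) (i j : ZMod L × ZMod L) :
    Mc L t m i j = (if j = i then m * (sg i.1 * sg i.2) else 0)
      + (if j = (i.1 + 1, i.2) then -t * sg i.2 else 0)
      + (if j = (i.1 - 1, i.2) then -t * sg i.2 else 0)
      + (if j = (i.1, i.2 + 1) then -(t : ℂ) else 0)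
      + (if j = (i.1, i.2 - 1) then -(t : ℂ) else 0) := by
  have h1 := one_ne hL
  have h2 := add_ne_sub hL
  have h3 : ∀ a : ZMod L, a + 1 ≠ a := fun a h => h1 (by simpa using h)
  have h4 : ∀ a : ZMod L, a - 1 ≠ a := fun a h => h1 (by simpa using h)
  obtain ⟨a, b⟩ := i
  obtain ⟨c, d⟩ := j
  simp only [Mc, Matrix.map_apply, piFluxM, Prod.mk.injEq]
  by_cases hc : c = a
  · subst hc
    by_cases hd : d = b
    · subst hd
      simp [(h3 _).symm, (h4 _).symm, sg, pow_add, h1]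
    · by_cases hd1 : d = b + 1
      · subst hd1
        simp [h1, (h3 _).symm, (h4 _).symm, h2 b]
      · by_cases hd2 : d = b - 1
        · subst hd2
          simp [h1, (h3 _).symm, (h4 _).symm, (h2 b).symm]
        · simp [hd, hd1, hd2]
  · by_cases hd : d = b
    · subst hd
      by_cases hd1 : c = a + 1
      · subst hd1
        simp [h1, h2 a, sg]
      · by_cases hd2 : c = a - 1
        · subst hd2
          simp [h1, (h2 a).symm, sg]
        · simp [hc, hd1, hd2]
    · simp [hc, hd]

lemma Mc_mulVec {L : ℕ} [NeZero L] (hL : 4 ∣ L) (t m : ℝ) (v : ZMod L × ZMod L → ℂ)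
    (a b : ZMod L) :
    (Mc L t m).mulVec v (a, b) = m * (sg a * sg b) * v (a, b)
      - t * sg b * (v (a + 1, b) + v (a - 1, b)) - t * (v (a, b + 1) + v (a, b - 1)) := by
  simp only [Matrix.mulVec, dotProduct, Mc_apply hL, add_mul, Finset.sum_add_distrib, ite_mul,
    zero_mul, Finset.sum_ite_eq', Finset.sum_ite_eq, Finset.mem_univ, if_true]
  ring

/-- Fourier matrix. -/
noncomputable def Fm (L : ℕ) [NeZero L] : Matrix (ZMod L × ZMod L) (ZMod L × ZMod L) ℂ :=
  fun i k => ZMod.stdAddChar (i.1 * k.1) * ZMod.stdAddChar (i.2 * k.2)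

/-- Inverse Fourier matrix up to scaling. -/
noncomputable def Gm (L : ℕ) [NeZero L] : Matrix (ZMod L × ZMod L) (ZMod L × ZMod L) ℂ :=
  fun k i => ZMod.stdAddChar (-(i.1 * k.1)) * ZMod.stdAddChar (-(i.2 * k.2))

lemma Fm_mul_Gm (L : ℕ) [NeZero L] : Fm L * Gm L = ((L : ℂ) ^ 2) • 1 := by
  ext ⟨a, b⟩ ⟨c, d⟩
  have key : ∀ x y : ZMod L, ∑ k : ZMod L,
      (ZMod.stdAddChar (x * k) * ZMod.stdAddChar (-(y * k)) : ℂ) = if x = y then (L : ℂ) else 0 := by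
    intro x y
    have := AddChar.sum_mulShift (x - y) (ZMod.isPrimitive_stdAddChar L)
    simp only [sub_eq_zero, ZMod.card] at this
    rw [Nat.cast_ite, Nat.cast_zero] at this
    rw [← this]
    refine Finset.sum_congr rfl fun k _ => ?_
    rw [← AddChar.map_add_eq_mul]
    congr 1
    ring
  have : (Fm L * Gm L) (a, b) (c, d) = (∑ k : ZMod L,
      (ZMod.stdAddChar (a * k) * ZMod.stdAddChar (-(c * k)) : ℂ)) * ∑ k : ZMod L,
      (ZMod.stdAddChar (b * k) * ZMod.stdAddChar (-(d * k)) : ℂ) := by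
    rw [Matrix.mul_apply, Fintype.sum_prod_type, Finset.sum_mul_sum]
    refine Finset.sum_congr rfl fun k _ => Finset.sum_congr rfl fun l _ => ?_
    simp only [Fm, Gm]
    ring
  rw [this, key, key]
  simp only [Matrix.smul_apply, Matrix.one_apply, Prod.mk.injEq, smul_eq_mul]
  by_cases h1 : a = c <;> by_cases h2 : b = d <;> simp [h1, h2, sq]

lemma Fm_det_ne (L : ℕ) [NeZero L] : (Fm L).det ≠ 0 := by
  intro h
  have := congrArg Matrix.det (Fm_mul_Gm L)
  rw [Matrix.det_mul, h, zero_mul, Matrix.det_smul, Matrix.det_one, mul_one] at this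
  exact pow_ne_zero _ (pow_ne_zero _ (Nat.cast_ne_zero.mpr (NeZero.ne L))) this.symm

/-- Eigenvalues of the squared Hamiltonian. -/
noncomputable def Ec {L : ℕ} [NeZero L] (t m : ℝ) (k : ZMod L × ZMod L) : ℂ :=
  m ^ 2 + t ^ 2 * (ZMod.stdAddChar k.1 + ZMod.stdAddChar (-k.1)) ^ 2
    + t ^ 2 * (ZMod.stdAddChar k.2 + ZMod.stdAddChar (-k.2)) ^ 2

lemma Msq_Fm {L : ℕ} [NeZero L] (hL : 4 ∣ L) (t m : ℝ) :
    Mc L t m * (Mc L t m * Fm L) = Fm L * Matrix.diagonal (Ec t m) := by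
  ext ⟨a, b⟩ ⟨p, q⟩
  have hmv : ∀ (A B : Matrix (ZMod L × ZMod L) (ZMod L × ZMod L) ℂ) i j,
      (A * B) i j = A.mulVec (fun l => B l j) i := fun A B i j => rfl
  rw [Matrix.mul_diagonal, hmv, Mc_mulVec hL]
  simp only [hmv, Mc_mulVec hL, sg_add_one hL, sg_sub_one hL]
  have e1 : ∀ x y : ZMod L, (ZMod.stdAddChar ((x + 1) * y) : ℂ)
      = ZMod.stdAddChar (x * y) * ZMod.stdAddChar y := by
    intro x y; rw [← AddChar.map_add_eq_mul]; congr 1; ring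
  have e2 : ∀ x y : ZMod L, (ZMod.stdAddChar ((x - 1) * y) : ℂ)
      = ZMod.stdAddChar (x * y) * ZMod.stdAddChar (-y) := by
    intro x y; rw [← AddChar.map_add_eq_mul]; congr 1; ring
  simp only [Fm, e1, e2, Ec]
  have ha := sg_sq a
  have hb := sg_sq b
  generalize sg a = α at *
  generalize sg b = β at *
  generalize (ZMod.stdAddChar (a * p) : ℂ) = u
  generalize (ZMod.stdAddChar (b * q) : ℂ) = v
  generalize (ZMod.stdAddChar p : ℂ) = P
  generalize (ZMod.stdAddChar q : ℂ) = Q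
  generalize (ZMod.stdAddChar (-p) : ℂ) = P'
  generalize (ZMod.stdAddChar (-q) : ℂ) = Q'
  linear_combination (m ^ 2 * u * v * β * β) * ha + (m ^ 2 * u * v
    + t ^ 2 * u * v * (P + P') ^ 2) * hb

/-- Operator anticommuting with the Hamiltonian. -/
noncomputable def Jm (L : ℕ) : Matrix (ZMod L × ZMod L) (ZMod L × ZMod L) ℂ :=
  fun i j => if j = (i.1 + 1, i.2) then sg i.1 * sg i.2 else 0

/-- Inverse of `Jm`. -/
noncomputable def Km (L : ℕ) : Matrix (ZMod L × ZMod L) (ZMod L × ZMod L) ℂ :=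
  fun i j => if j = (i.1 - 1, i.2) then -(sg i.1 * sg i.2) else 0

lemma Jm_mulVec {L : ℕ} [NeZero L] (v : ZMod L × ZMod L → ℂ) (a b : ZMod L) :
    (Jm L).mulVec v (a, b) = sg a * sg b * v (a + 1, b) := by
  simp [Matrix.mulVec, dotProduct, Jm, ite_mul]

lemma Km_mulVec {L : ℕ} [NeZero L] (v : ZMod L × ZMod L → ℂ) (a b : ZMod L) :
    (Km L).mulVec v (a, b) = -(sg a * sg b) * v (a - 1, b) := by
  simp [Matrix.mulVec, dotProduct, Km, ite_mul]

lemma Jm_det_ne {L : ℕ} [NeZero L] (hL : 4 ∣ L) : (Jm L).det ≠ 0 := by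
  have h : Jm L * Km L = 1 := by
    apply Matrix.mulVec_injective
    funext v
    funext ⟨a, b⟩
    rw [← Matrix.mulVec_mulVec, Jm_mulVec, Km_mulVec, Matrix.one_mulVec, sg_add_one hL,
      add_sub_cancel_right]
    linear_combination (sg b * sg b * v (a, b)) * sg_sq a + v (a, b) * sg_sq b
  exact Matrix.det_ne_zero_of_right_inverse h

lemma Jm_anti {L : ℕ} [NeZero L] (hL : 4 ∣ L) (t m : ℝ) :
    Jm L * Mc L t m = - (Mc L t m * Jm L) := by
  apply Matrix.mulVec_injective
  funext v
  funext ⟨a, b⟩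
  rw [Matrix.neg_mulVec, Pi.neg_apply, ← Matrix.mulVec_mulVec, ← Matrix.mulVec_mulVec,
    Jm_mulVec, Mc_mulVec hL, Mc_mulVec hL]
  simp only [Jm_mulVec, sg_add_one hL, sg_sub_one hL, add_sub_cancel_right, sub_add_cancel]
  ring

lemma det_sq {L : ℕ} [NeZero L] (hL : 4 ∣ L) (t m : ℝ) (x : ℂ) :
    (Matrix.scalar _ x - Mc L t m).det ^ 2 = ∏ k : ZMod L × ZMod L, (x ^ 2 - Ec t m k) := by
  have hs : ∀ A : Matrix (ZMod L × ZMod L) (ZMod L × ZMod L) ℂ,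
      A * Matrix.scalar _ x = Matrix.scalar _ x * A := fun A =>
    (Matrix.scalar_commute x (fun r => mul_comm _ _) A).symm
  have h1 : (Matrix.scalar _ x - Mc L t m).det = (Matrix.scalar _ x + Mc L t m).det := by
    have : Jm L * (Matrix.scalar _ x - Mc L t m) = (Matrix.scalar _ x + Mc L t m) * Jm L := by
      rw [mul_sub, add_mul, Jm_anti hL, hs, sub_neg_eq_add]
    have := congrArg Matrix.det this
    rw [Matrix.det_mul, Matrix.det_mul, mul_comm] at this
    exact mul_right_cancel₀ (Jm_det_ne hL) this
  have h2 : (Matrix.scalar _ x - Mc L t m) * (Matrix.scalar _ x + Mc L t m) * Fm L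
      = Fm L * Matrix.diagonal (fun k => x ^ 2 - Ec t m k) := by
    have : Matrix.diagonal (fun k => x ^ 2 - Ec t m k)
        = Matrix.scalar (ZMod L × ZMod L) x * Matrix.scalar _ x - Matrix.diagonal (Ec t m) := by
      rw [← map_mul, ← sq]
      simp [Matrix.scalar_apply, Matrix.diagonal_sub]
    rw [this, mul_sub (Fm L), ← Msq_Fm hL, ← mul_assoc (Fm L), hs (Fm L), mul_assoc (Matrix.scalar _ x) (Fm L) (Matrix.scalar _ x), hs (Fm L)]
    have h3 := hs (Mc L t m)
    simp only [sub_mul, mul_add, add_mul, h3, mul_assoc]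
    abel
  have := congrArg Matrix.det h2
  rw [Matrix.det_mul, Matrix.det_mul, Matrix.det_mul, ← h1, mul_comm, Matrix.det_diagonal] at this
  rw [sq]
  exact mul_left_cancel₀ (Fm_det_ne L) this

lemma char_cos {L : ℕ} [NeZero L] (k : ℕ) :
    ((ZMod.stdAddChar ((k : ℕ) : ZMod L) : ℂ) + ZMod.stdAddChar (-((k : ℕ) : ZMod L))) ^ 2
      = ((2 + 2 * Real.cos (4 * Real.pi * k / L) : ℝ) : ℂ) := by
  have h1 := ZMod.stdAddChar_coe (N := L) (k : ℤ)
  have h2 := ZMod.stdAddChar_coe (N := L) (-(k : ℤ))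
  push_cast at h1 h2
  have h3 : (4 * Real.pi * k / L : ℝ) = 2 * (2 * Real.pi * k / L) := by ring
  rw [h1, h2, h3, Real.cos_two_mul]
  have h4 : Complex.exp (2 * Real.pi * Complex.I * k / L)
      + Complex.exp (2 * Real.pi * Complex.I * -k / L)
      = 2 * Complex.cos (2 * Real.pi * k / L) := by
    rw [Complex.two_cos]
    congr 2 <;> ring
  rw [h4]
  push_cast
  ring

lemma prod_zmod {L : ℕ} [NeZero L] (h2 : 2 ∣ L) (f : ZMod L → ℂ) (g : ℕ → ℂ)
    (hfg : ∀ n : ℕ, f (n : ZMod L) = g n) (hg : ∀ n, g (L / 2 + n) = g n) :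
    ∏ k, f k = (∏ n ∈ Finset.range (L / 2), g n) ^ 2 := by
  have h : ∏ k, f k = ∏ n ∈ Finset.range L, g n := by
    symm
    refine Finset.prod_bij (fun n _ => (n : ZMod L)) (by simp) ?_ ?_ ?_
    · intro a ha b hb hab
      rw [Finset.mem_range] at ha hb
      have := congrArg ZMod.val hab
      rwa [ZMod.val_natCast_of_lt ha, ZMod.val_natCast_of_lt hb] at this
    · intro b _
      exact ⟨b.val, Finset.mem_range.mpr (ZMod.val_lt b), ZMod.natCast_zmod_val b⟩
    · intro a _
      exact (hfg a).symm
  have hL2 : L = L / 2 + L / 2 := by omega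
  rw [h, sq]
  conv_lhs => rw [hL2]
  rw [Finset.prod_range_add]
  simp only [hg]

end PiFlux

open PiFlux in
/-- The characteristic polynomial of the one-body π-flux Hamiltonian on the `L × L` torus
(`L` a positive multiple of 4) is
`Π_{n₁,n₂=0}^{L/2−1} (X² − (m² + 4t² + 2t²cos(4πn₁/L) + 2t²cos(4πn₂/L)))²`;
in particular its eigenvalues are `±√(m² + 4t² + 2t²cos 2k₁ + 2t²cos 2k₂)` for `k` in the
Brillouin zone `B_L(1,1)`, each appearing twice. -/
theorem piFluxM_charpoly (L : ℕ) [NeZero L] (hL : 4 ∣ L) (t m : ℝ) :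
    (piFluxM L t m).charpoly =
      ∏ n₁ ∈ Finset.range (L / 2), ∏ n₂ ∈ Finset.range (L / 2),
        (X ^ 2 - C (m ^ 2 + 4 * t ^ 2
          + 2 * t ^ 2 * Real.cos (4 * Real.pi * n₁ / L)
          + 2 * t ^ 2 * Real.cos (4 * Real.pi * n₂ / L))) ^ 2 := by
  have h2 : 2 ∣ L := dvd_trans (by norm_num) hL
  have hLR : (L : ℝ) ≠ 0 := Nat.cast_ne_zero.mpr (NeZero.ne L)
  have hcos : ∀ n : ℕ, Real.cos (4 * Real.pi * (L / 2 + n : ℕ) / L)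
      = Real.cos (4 * Real.pi * n / L) := by
    intro n
    rw [← Real.cos_add_two_pi (4 * Real.pi * n / L)]
    congr 1
    push_cast [Nat.cast_div h2 (two_ne_zero : ((2 : ℕ) : ℝ) ≠ 0)]
    field_simp
    ring
  set Q : ℝ[X] := ∏ n₁ ∈ Finset.range (L / 2), ∏ n₂ ∈ Finset.range (L / 2),
        (X ^ 2 - C (m ^ 2 + 4 * t ^ 2
          + 2 * t ^ 2 * Real.cos (4 * Real.pi * n₁ / L)
          + 2 * t ^ 2 * Real.cos (4 * Real.pi * n₂ / L))) ^ 2 with hQ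
  have hQm : Q.Monic := by
    refine monic_prod_of_monic _ _ fun i _ => monic_prod_of_monic _ _ fun j _ => ?_
    exact (monic_X_pow_sub_C _ two_ne_zero).pow 2
  have hPm := (piFluxM L t m).charpoly_monic
  have hsq : (piFluxM L t m).charpoly ^ 2 = Q ^ 2 := by
    apply Polynomial.map_injective (algebraMap ℝ ℂ) (algebraMap ℝ ℂ).injective
    apply Polynomial.funext
    intro x
    rw [Polynomial.map_pow, Polynomial.map_pow, eval_pow, eval_pow, ← Matrix.charpoly_map,
      Matrix.eval_charpoly]
    have hd := det_sq hL t m x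
    rw [Mc] at hd
    rw [hd, Fintype.prod_prod_type]
    set G : ℕ → ℕ → ℂ := fun a b => x ^ 2 - ((m ^ 2 + 4 * t ^ 2
          + 2 * t ^ 2 * Real.cos (4 * Real.pi * a / L)
          + 2 * t ^ 2 * Real.cos (4 * Real.pi * b / L) : ℝ) : ℂ) with hG
    have hE : ∀ a b : ℕ, x ^ 2 - Ec t m ((a : ZMod L), (b : ZMod L)) = G a b := by
      intro a b
      simp only [Ec, char_cos, hG]
      push_cast
      ring
    rw [prod_zmod h2 _ (fun a => (∏ b ∈ Finset.range (L / 2), G a b) ^ 2)]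
    · simp only [hQ, Polynomial.map_prod, eval_prod, Polynomial.map_pow, eval_pow,
        Polynomial.map_sub, eval_sub, map_X, eval_X, map_C, eval_C, Finset.prod_pow]
      rfl
    · intro a
      refine prod_zmod h2 _ _ (fun b => hE a b) ?_
      intro b
      simp only [hG, hcos]
    · intro a
      simp only [hG, hcos]
  rcases sq_eq_sq_iff_eq_or_eq_neg.mp hsq with h | h
  · exact h
  · exfalso
    have := congrArg leadingCoeff h
    rw [leadingCoeff_neg, hPm.leadingCoeff, hQm.leadingCoeff] at this
    norm_num at this
end
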